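/- Let γ > 0 be irrational, n a positive integer, and m, l positive integers with gcd(m,l)=1 satisfying |l/m - 1/γ| < 1/(2n m²). Let η₁ be the unique integer with 0 ≤ η₁ ≤ m-1 such that η₂ := (1 - l η₁ - nl - m)/m is an integer. Then (η₁, η₂) ∈ Λ_{γ,n}, i.e., η₁ + γ(η₂ + 1) > -n. -/

import Mathlib

/-- If `γ > 0` is irrational, `gcd(m,l) = 1`, `|l/m - 1/γ| < 1/(2nm²)`, and `η₁` is the
unique integer in `{0,…,m-1}` with `η₂ = (1 - lη₁ - nl - m)/m ∈ ℤ`, then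
`(η₁, η₂) ∈ Λ_{γ,n}`, i.e. `η₁ + γ(η₂+1) > -n`. -/
theorem multiindex_mem_Lambda_of_rational_approx
    (γ : ℝ) (hγ : 0 < γ) (hirr : Irrational γ)
    (n m l : ℕ) (hn : 0 < n) (hm : 0 < m) (hl : 0 < l) (hgcd : Nat.gcd m l = 1)
    (happrox : |(l : ℝ) / m - 1 / γ| < 1 / (2 * n * (m : ℝ) ^ 2))
    (η₁ : ℕ) (hη₁ : η₁ ≤ m - 1) (η₂ : ℤ)
    (hη₂ : (m : ℤ) * η₂ = 1 - l * η₁ - n * l - m) :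
    (η₁ : ℝ) + γ * ((η₂ : ℝ) + 1) > -n := by
  have hmR : (0 : ℝ) < m := by exact_mod_cast hm
  have hnR : (0 : ℝ) < n := by exact_mod_cast hn
  have hk : (0 : ℝ) < (η₁ : ℝ) + n := by positivity
  have hk_le : (η₁ : ℝ) + n ≤ m * n := by
    have h : η₁ + n ≤ m * n := by
      have h1 : η₁ + 1 ≤ m := by omega
      nlinarith
    exact_mod_cast h
  have hη₂R : (m : ℝ) * η₂ = 1 - l * η₁ - n * l - m := by exact_mod_cast hη₂
  have hshift : (η₂ : ℝ) + 1 = 1 / m - ((η₁ : ℝ) + n) * (l / m) := by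
    field_simp
    linarith
  have hbound : ((η₁ : ℝ) + n) * ((l : ℝ) / m - 1 / γ) < 1 / m :=
    calc ((η₁ : ℝ) + n) * ((l : ℝ) / m - 1 / γ)
        < ((η₁ : ℝ) + n) * (1 / (2 * n * (m : ℝ) ^ 2)) :=
          mul_lt_mul_of_pos_left ((le_abs_self _).trans_lt happrox) hk
      _ ≤ (m * n) * (1 / (2 * n * (m : ℝ) ^ 2)) := by gcongr
      _ = 1 / m / 2 := by field_simp
      _ < 1 / m := half_lt_self (by positivity)
  have hfactor : (η₁ : ℝ) + γ * ((η₂ : ℝ) + 1) + n =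
      γ * (1 / m - ((η₁ : ℝ) + n) * ((l : ℝ) / m - 1 / γ)) := by
    rw [hshift]
    field_simp
    ring
  have hpos := mul_pos hγ (sub_pos.mpr hbound)
  linarith
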